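/- arXiv:1111.1354 — 3 statements merged into one kernel-verified Lean document; each statement's English description precedes it below -/
import Mathlib

section
/- Let G be a finite group acting on a set M, and let x, y ∈ M be elements such that M = G·x ∪ G·y and such that for every g ∈ G the set {x, y} intersects {g·x, g·y} nontrivially. Then one of the following three cases holds: (1) x or y is a fixed point of the G-action (in particular M^G is nonempty); (2) M = {x, y} has exactly two elements and G acts transitively on M; (3) M = {x, y, z} has exactly three elements and G acts transitively on M. -/
theorem ncard_transporter {G M : Type*} [Group G] [MulAction G M] (x a b : M)
    (ha : ∃ p : G, p • x = a) (hb : ∃ q : G, q • x = b) :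
    {g : G | g • a = b}.ncard = {g : G | g • x = x}.ncard := by
  obtain ⟨p, rfl⟩ := ha
  obtain ⟨q, rfl⟩ := hb
  symm
  refine Set.ncard_congr (fun g _ => q * g * p⁻¹) ?_ ?_ ?_
  · intro g hg
    have hg' : g • x = x := hg
    simp [mul_smul, hg']
  · intro g h _ _ e
    simpa using e
  · intro g hg
    have hg' : g • p • x = q • x := hg
    refine ⟨q⁻¹ * g * p, ?_, by group⟩
    simp [mul_smul, hg']


/-- **Combinatorial fixed point lemma.** Let `G` be a finite group acting on a set `M`,
and `x y : M` such that `M = G·x ∪ G·y` and for every `g ∈ G` the set `{x, y}` meets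
`{g·x, g·y}`. Then either `x` or `y` is fixed by `G`, or `M = {x, y}` has two elements
and `G` acts transitively, or `M = {x, y, z}` has three elements and `G` acts
transitively. -/
theorem stmt0 {G M : Type*} [Group G] [Finite G] [MulAction G M] (x y : M)
    (hcover : ∀ m : M, m ∈ MulAction.orbit G x ∪ MulAction.orbit G y)
    (hmeet : ∀ g : G, (({x, y} : Set M) ∩ {g • x, g • y}).Nonempty) :
    ((∀ g : G, g • x = x) ∨ (∀ g : G, g • y = y)) ∨
    ((Set.univ : Set M) = {x, y} ∧ x ≠ y ∧ ∀ a b : M, ∃ g : G, g • a = b) ∨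
    (∃ z : M, (Set.univ : Set M) = {x, y, z} ∧ x ≠ y ∧ x ≠ z ∧ y ≠ z ∧
      ∀ a b : M, ∃ g : G, g • a = b) := by
  have h4 : ∀ g : G, g • x = x ∨ g • y = y ∨ g • x = y ∨ g • y = x := by
    intro g
    obtain ⟨m, hm1, hm2⟩ := hmeet g
    simp only [Set.mem_insert_iff, Set.mem_singleton_iff] at hm1 hm2
    grind
  by_cases hxy : ∃ g : G, g • x = y
  · have htr : ∀ m : M, ∃ g : G, g • x = m := by
      intro m
      obtain ⟨p, hp⟩ := hxy
      rcases hcover m with ⟨g, hg⟩ | ⟨g, hg⟩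
      · exact ⟨g, hg⟩
      · refine ⟨g * p, ?_⟩
        rw [mul_smul, hp]
        exact hg
    have htr2 : ∀ a b : M, ∃ g : G, g • a = b := by
      intro a b
      obtain ⟨p, rfl⟩ := htr a
      obtain ⟨q, rfl⟩ := htr b
      exact ⟨q * p⁻¹, by simp [mul_smul]⟩
    by_cases hne : x = y
    · subst hne
      left; left
      intro g
      have := h4 g
      tauto
    right
    have hfin : Finite M := Finite.of_surjective (fun g : G => g • x) htr
    have horb : Nat.card M * {g : G | g • x = x}.ncard = Nat.card G := by
      have h1 : (MulAction.orbit G x) = Set.univ := Set.eq_univ_of_forall htr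
      have h2 := MulAction.index_stabilizer G x
      have h3 := (MulAction.stabilizer G x).index_mul_card
      rw [h2, h1, Set.ncard_univ] at h3
      exact h3
    have hcov : (Set.univ : Set G) = ({g : G | g • x = x} ∪ {g : G | g • y = y}) ∪
        ({g : G | g • x = y} ∪ {g : G | g • y = x}) := by
      ext g
      have := h4 g
      simp only [Set.mem_univ, Set.mem_union, Set.mem_setOf_eq, true_iff]
      tauto
    have c1 := ncard_transporter x y y (htr y) (htr y)
    have c2 := ncard_transporter x x y (htr x) (htr y)
    have c3 := ncard_transporter x y x (htr y) (htr x)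
    have u1 := Set.ncard_union_add_ncard_inter {g : G | g • x = x} {g : G | g • y = y}
    have u2 := Set.ncard_union_le {g : G | g • x = y} {g : G | g • y = x}
    have u3 := Set.ncard_union_le ({g : G | g • x = x} ∪ {g : G | g • y = y})
        ({g : G | g • x = y} ∪ {g : G | g • y = x})
    rw [← hcov, Set.ncard_univ] at u3
    have u4 : 0 < ({g : G | g • x = x} ∩ {g : G | g • y = y}).ncard :=
      (Set.ncard_pos).2 ⟨1, by simp⟩
    have hlt : Nat.card M < 4 := by
      by_contra hcon
      have := Nat.mul_le_mul_right ({g : G | g • x = x}.ncard) (not_lt.1 hcon)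
      omega
    by_cases hz : ∃ z : M, z ≠ x ∧ z ≠ y
    · right
      obtain ⟨z, hzx, hzy⟩ := hz
      refine ⟨z, ?_, hne, hzx.symm, hzy.symm, htr2⟩
      symm
      apply Set.eq_of_subset_of_ncard_le (Set.subset_univ _)
      rw [Set.ncard_univ, Set.ncard_eq_three.2 ⟨x, y, z, hne, hzx.symm, hzy.symm, rfl⟩]
      omega
    · left
      refine ⟨?_, hne, htr2⟩
      ext m
      simp only [Set.mem_univ, Set.mem_insert_iff, Set.mem_singleton_iff, true_iff]
      by_contra hm
      exact hz ⟨m, by tauto, by tauto⟩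
  · left
    have h2 : ∀ g : G, g • x = x ∨ g • y = y := by
      intro g
      rcases h4 g with h | h | h | h
      · exact Or.inl h
      · exact Or.inr h
      · exact absurd ⟨g, h⟩ hxy
      · exact absurd ⟨g⁻¹, by rw [← h, inv_smul_smul]⟩ hxy
    by_contra hcon
    push Not at hcon
    obtain ⟨⟨a, ha⟩, ⟨b, hb⟩⟩ := hcon
    have hay : a • y = y := (h2 a).resolve_left ha
    have hbx : b • x = x := (h2 b).resolve_right hb
    rcases h2 (a * b) with h | h
    · rw [mul_smul, hbx] at h
      exact ha h
    · rw [mul_smul] at h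
      exact hb (MulAction.injective a (h.trans hay.symm))
end

section
/- Let G be a group acting on a finite nonempty graph Γ by graph automorphisms. If Γ is a tree, then the G-action on Γ has a fixed point which is either a vertex or an edge: that is, there exists a vertex v with g·v = v for all g ∈ G, or there exists an edge {a, b} of Γ with g·{a, b} = {a, b} (as an unordered pair) for all g ∈ G. -/
theorem tree_dist_convex {V : Type*} (Γ : SimpleGraph V) (hΓ : Γ.IsTree) {a b c : V}
    (hab : Γ.Adj a b) (hbc : Γ.Adj b c) (hac : a ≠ c) (u : V) :
    2 * Γ.dist u b ≤ Γ.dist u a + Γ.dist u c := by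
  by_contra hlt
  have h1 := hΓ.dist_eq_dist_add_one_of_adj u hab
  have h2 := hΓ.dist_eq_dist_add_one_of_adj u hbc
  have h3 : Γ.dist u b = Γ.dist u a + 1 := by omega
  have h4 : Γ.dist u b = Γ.dist u c + 1 := by omega
  obtain ⟨p, hp⟩ := hΓ.1.exists_walk_length_eq_dist a u
  obtain ⟨q, hq⟩ := hΓ.1.exists_walk_length_eq_dist c u
  have hp' : (SimpleGraph.Walk.cons hab.symm p).IsPath := by
    apply SimpleGraph.Walk.isPath_of_length_eq_dist
    rw [SimpleGraph.Walk.length_cons, hp, Γ.dist_comm, ← h3, Γ.dist_comm]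
  have hq' : (SimpleGraph.Walk.cons hbc q).IsPath := by
    apply SimpleGraph.Walk.isPath_of_length_eq_dist
    rw [SimpleGraph.Walk.length_cons, hq, Γ.dist_comm, ← h4, Γ.dist_comm]
  have h := (hΓ.existsUnique_path b u).unique hp' hq'
  have h' := congrArg SimpleGraph.Walk.snd h
  simp at h'
  exact hac h'

theorem path_convex {V : Type*} (Γ : SimpleGraph V) (f : V → ℕ)
    (hf : ∀ a b c, Γ.Adj a b → Γ.Adj b c → a ≠ c → 2 * f b < f a + f c) {b w : V}
    (p : Γ.Walk b w) : ∀ a (h : Γ.Adj a b), (SimpleGraph.Walk.cons h p).IsPath → f a ≤ f b →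
      f b ≤ f w ∧ (b ≠ w → f b < f w) := by
  induction p with
  | nil => intro a h _ _; simp
  | @cons b c w h' p ih =>
    intro a h hp hle
    have hac : a ≠ c := by
      rintro rfl
      simp [SimpleGraph.Walk.cons_isPath_iff] at hp
    have := hf a b c h h' hac
    have := (ih b h' hp.of_cons (by omega)).1
    refine ⟨by omega, fun _ => by omega⟩

theorem graph_dist_smul_le {G V : Type*} [Group G] [MulAction G V]
    (Γ : SimpleGraph V) (hΓ : Γ.Connected)
    (hact : ∀ (g : G) (u v : V), Γ.Adj (g • u) (g • v) ↔ Γ.Adj u v) (g : G) (u v : V) :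
    Γ.dist (g • u) (g • v) ≤ Γ.dist u v := by
  obtain ⟨p, hp⟩ := hΓ.exists_walk_length_eq_dist u v
  let φ : Γ →g Γ := ⟨fun x => g • x, fun {a b} h => (hact g a b).2 h⟩
  rw [← hp, ← SimpleGraph.Walk.length_map φ p]
  exact SimpleGraph.dist_le (p.map φ)

/-- A group acting by graph automorphisms on a finite nonempty tree fixes a vertex or
an edge (possibly swapping the endpoints of the edge). -/
theorem stmt2 {G V : Type*} [Group G] [Fintype V] [Nonempty V] [MulAction G V]
    (Γ : SimpleGraph V) (hΓ : Γ.IsTree)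
    (hact : ∀ (g : G) (u v : V), Γ.Adj (g • u) (g • v) ↔ Γ.Adj u v) :
    (∃ v : V, ∀ g : G, g • v = v) ∨
    (∃ a b : V, Γ.Adj a b ∧ ∀ g : G, ({g • a, g • b} : Set V) = {a, b}) := by
  have hd : ∀ (g : G) (u v : V), Γ.dist (g • u) (g • v) = Γ.dist u v := by
    intro g u v
    apply le_antisymm (graph_dist_smul_le Γ hΓ.1 hact g u v)
    simpa using graph_dist_smul_le Γ hΓ.1 hact g⁻¹ (g • u) (g • v)
  let f : V → ℕ := fun v => ∑ u, Γ.dist u v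
  have hfg : ∀ (g : G) v, f (g • v) = f v := by
    intro g v
    change ∑ u, Γ.dist u (g • v) = ∑ u, Γ.dist u v
    rw [← Equiv.sum_comp (MulAction.toPerm g)]
    exact Finset.sum_congr rfl fun u _ => hd g u v
  have hf : ∀ a b c, Γ.Adj a b → Γ.Adj b c → a ≠ c → 2 * f b < f a + f c := by
    intro a b c hab hbc hac
    change 2 * ∑ u, Γ.dist u b < ∑ u, Γ.dist u a + ∑ u, Γ.dist u c
    rw [Finset.mul_sum, ← Finset.sum_add_distrib]
    apply Finset.sum_lt_sum (fun u _ => tree_dist_convex Γ hΓ hab hbc hac u)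
    refine ⟨b, Finset.mem_univ _, ?_⟩
    rw [SimpleGraph.dist_self, SimpleGraph.dist_eq_one_iff_adj.2 hab.symm]
    omega
  obtain ⟨m, hm⟩ := Finite.exists_min f
  have key : ∀ x y, f x = f m → f y = f m → x ≠ y → Γ.Adj x y := by
    intro x y hx hy hxy
    obtain ⟨p, hp, -⟩ := hΓ.existsUnique_path x y
    cases p with
    | nil => exact absurd rfl hxy
    | @cons _ b _ h p =>
      have h1 := (path_convex Γ f hf p x h hp (by rw [hx]; exact hm b)).2
      by_cases hb : b = y
      · exact hb ▸ h
      · have := h1 hb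
        have := hm b
        omega
  by_cases hfix : ∀ g : G, g • m = m
  · exact Or.inl ⟨m, hfix⟩
  · push Not at hfix
    obtain ⟨g₀, hg₀⟩ := hfix
    have hab := key m (g₀ • m) rfl (hfg _ _) hg₀.symm
    have two : ∀ x, f x = f m → x = m ∨ x = g₀ • m := by
      intro x hx
      by_contra! hc
      have h1 := key x m hx rfl hc.1
      have h2 := key x (g₀ • m) hx (hfg _ _) hc.2
      apply hΓ.dist_ne_of_adj x hab
      rw [SimpleGraph.dist_eq_one_iff_adj.2 h1, SimpleGraph.dist_eq_one_iff_adj.2 h2]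
    refine Or.inr ⟨m, g₀ • m, hab, fun g => ?_⟩
    have h1 := two (g • m) (hfg _ _)
    have h2 := two (g • g₀ • m) (by rw [hfg, hfg])
    have h3 : g • m ≠ g • g₀ • m := fun h => hg₀ (MulAction.injective g h).symm
    rcases h1 with h1 | h1 <;> rcases h2 with h2 | h2
    · exact absurd (h1.trans h2.symm) h3
    · rw [h1, h2]
    · rw [h1, h2, Set.pair_comm]
    · exact absurd (h1.trans h2.symm) h3
end

section
/- Let K be a field and 𝔬 ⊆ K a subring. Consider the set Val_𝔬(K) of all valuation subrings R of K containing 𝔬, and the injective 'sign' map Val_𝔬(K) → ∏_{f ∈ K×} {−, 0, +} that assigns to R the family of signs where the sign of f is 0 if both f ∈ R and f⁻¹ ∈ R, is + if f ∈ R and f⁻¹ ∉ R, and is − if f ∉ R. Then the image of the sign map is a closed subset of the profinite product space ∏_{f ∈ K×} {−, 0, +}; consequently Val_𝔬(K), endowed with the induced (patch) topology, is a compact Hausdorff totally disconnected (profinite) space. -/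
open Classical in
/-- The sign pattern attached to a valuation subring `R` of a field `K`: a nonzero
element `f` of `K` gets sign `0` if both `f` and `f⁻¹` lie in `R`, sign `+1` if
`f ∈ R` but `f⁻¹ ∉ R`, and sign `-1` if `f ∉ R`. -/
noncomputable def valSign {K : Type*} [Field K] (R : ValuationSubring K) :
    {f : K // f ≠ 0} → SignType :=
  fun f => if (f : K) ∈ R then (if ((f : K)⁻¹ ∈ R) then 0 else 1) else -1

/-- `Val_𝔬(K)`: the valuation subrings of `K` containing the subring `𝔬`. -/
def ValO (K : Type*) [Field K] (O : Subring K) : Type _ :=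
  {R : ValuationSubring K // O ≤ R.toSubring}

theorem valSign_ne_iff {K : Type*} [Field K] (R : ValuationSubring K) (f : {f : K // f ≠ 0}) :
    valSign R f ≠ -1 ↔ (f : K) ∈ R := by
  unfold valSign
  split_ifs <;> simp_all

theorem isClosed_three {ι : Type*} (P : SignType → SignType → SignType → Prop) (a b c : ι) :
    IsClosed {s : ι → SignType | P (s a) (s b) (s c)} := by
  have hc : Continuous (fun s : ι → SignType => (s a, s b, s c)) := by fun_prop
  exact (isClosed_discrete {t : SignType × SignType × SignType | P t.1 t.2.1 t.2.2}).preimage hc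

/-- Closed conditions cutting out the image of the sign map. -/
def GoodSign {K : Type*} [Field K] (O : Subring K) (s : {f : K // f ≠ 0} → SignType) : Prop :=
  (∀ f : {f : K // f ≠ 0}, (s f = 0 ↔ s f ≠ -1 ∧ s ⟨f.1⁻¹, inv_ne_zero f.2⟩ ≠ -1)) ∧
  (∀ f : {f : K // f ≠ 0}, s f ≠ -1 ∨ s ⟨f.1⁻¹, inv_ne_zero f.2⟩ ≠ -1) ∧
  (∀ f g : {f : K // f ≠ 0}, s f ≠ -1 → s g ≠ -1 → s ⟨f.1 * g.1, mul_ne_zero f.2 g.2⟩ ≠ -1) ∧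
  (∀ f g : {f : K // f ≠ 0}, ∀ h : f.1 + g.1 ≠ 0, s f ≠ -1 → s g ≠ -1 →
    s ⟨f.1 + g.1, h⟩ ≠ -1) ∧
  (∀ f : {f : K // f ≠ 0}, f.1 ∈ O → s f ≠ -1)

theorem isClosed_goodSign {K : Type*} [Field K] (O : Subring K) :
    IsClosed {s | GoodSign O s} := by
  unfold GoodSign
  simp only [Set.ofPred_and, Set.ofPred_forall]
  refine IsClosed.inter ?_ (IsClosed.inter ?_ (IsClosed.inter ?_ (IsClosed.inter ?_ ?_)))
  · exact isClosed_iInter fun f =>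
      isClosed_three (fun x y _ => (x = 0 ↔ x ≠ -1 ∧ y ≠ -1)) f ⟨f.1⁻¹, inv_ne_zero f.2⟩ f
  · exact isClosed_iInter fun f =>
      isClosed_three (fun x y _ => (x ≠ -1 ∨ y ≠ -1)) f ⟨f.1⁻¹, inv_ne_zero f.2⟩ f
  · exact isClosed_iInter fun f => isClosed_iInter fun g =>
      isClosed_three (fun x y z => (x ≠ -1 → y ≠ -1 → z ≠ -1)) f g
        ⟨f.1 * g.1, mul_ne_zero f.2 g.2⟩
  · exact isClosed_iInter fun f => isClosed_iInter fun g => isClosed_iInter fun h =>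
      isClosed_three (fun x y z => (x ≠ -1 → y ≠ -1 → z ≠ -1)) f g ⟨f.1 + g.1, h⟩
  · exact isClosed_iInter fun f => isClosed_iInter fun _ =>
      isClosed_three (fun x _ _ => x ≠ -1) f f f

/-- The valuation subring attached to a good sign pattern. -/
def GoodSign.ring {K : Type*} [Field K] {O : Subring K} {s : {f : K // f ≠ 0} → SignType}
    (H : GoodSign O s) : ValuationSubring K where
  carrier := {f | ∀ h : f ≠ 0, s ⟨f, h⟩ ≠ -1}
  mul_mem' := by
    intro a b ha hb h
    exact H.2.2.1 ⟨a, left_ne_zero_of_mul h⟩ ⟨b, right_ne_zero_of_mul h⟩ (ha _) (hb _)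
  one_mem' := fun h => H.2.2.2.2 ⟨1, h⟩ O.one_mem
  add_mem' := by
    intro a b ha hb h
    by_cases h1 : a = 0
    · subst h1
      simp only [zero_add] at h ⊢
      exact hb h
    by_cases h2 : b = 0
    · subst h2
      simp only [add_zero] at h ⊢
      exact ha h
    exact H.2.2.2.1 ⟨a, h1⟩ ⟨b, h2⟩ h (ha _) (hb _)
  zero_mem' := fun h => absurd rfl h
  neg_mem' := by
    intro a ha h
    have ha0 : a ≠ 0 := neg_ne_zero.mp h
    have h1 : (-1 : K) ≠ 0 := neg_ne_zero.mpr one_ne_zero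
    have := H.2.2.1 ⟨-1, h1⟩ ⟨a, ha0⟩ (H.2.2.2.2 _ (O.neg_mem O.one_mem)) (ha _)
    simpa only [neg_one_mul] using this
  mem_or_inv_mem' := by
    intro a
    by_cases h : a = 0
    · exact Or.inl fun h' => absurd h h'
    · exact (H.2.1 ⟨a, h⟩).imp (fun h' _ => h') (fun h' _ => h')

theorem goodSign_valSign {K : Type*} [Field K] (O : Subring K) (R : ValO K O) :
    GoodSign O (valSign R.1) := by
  simp only [GoodSign, valSign_ne_iff]
  refine ⟨fun f => ?_, fun f => R.1.mem_or_inv_mem f.1, fun f g => R.1.mul_mem _ _,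
    fun f g _ => R.1.add_mem _ _, fun f hf => R.2 hf⟩
  unfold valSign
  split_ifs <;> simp_all

theorem GoodSign.valSign_ring {K : Type*} [Field K] {O : Subring K}
    {s : {f : K // f ≠ 0} → SignType} (H : GoodSign O s) : valSign H.ring = s := by
  have key : ∀ f : {f : K // f ≠ 0}, (f : K) ∈ H.ring ↔ s f ≠ -1 :=
    fun f => ⟨fun h => h f.2, fun h _ => h⟩
  funext f
  have k1 := key f
  have k2 := key ⟨f.1⁻¹, inv_ne_zero f.2⟩
  have k3 := H.1 f
  simp only at k2
  unfold valSign
  rw [k1, k2]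
  generalize s ⟨f.1⁻¹, inv_ne_zero f.2⟩ = y at *
  generalize s f = x at *
  clear k1 k2 key
  have k4 : x = -1 ∨ x = 0 ∨ x = 1 := by
    clear k3
    revert x
    decide
  split_ifs <;> rcases k4 with rfl | rfl | rfl <;> simp_all

theorem range_valSign {K : Type*} [Field K] (O : Subring K) :
    (Set.range fun R : ValO K O => valSign R.1) = {s | GoodSign O s} := by
  ext s
  constructor
  · rintro ⟨R, rfl⟩
    exact goodSign_valSign O R
  · intro H
    exact ⟨⟨GoodSign.ring H, fun f hf h => H.2.2.2.2 ⟨f, h⟩ hf⟩, GoodSign.valSign_ring H⟩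

/-- The sign map `Val_𝔬(K) → ∏_{f ∈ K×} {−, 0, +}` is injective and its image is a
closed subset of the profinite product; consequently `Val_𝔬(K)` with the induced
(patch) topology is compact, Hausdorff and totally disconnected (profinite). -/
theorem stmt5 {K : Type*} [Field K] (O : Subring K) :
    Function.Injective (fun R : ValO K O => valSign R.1) ∧
    IsClosed (Set.range fun R : ValO K O => valSign R.1) ∧
    (letI : TopologicalSpace (ValO K O) :=
        TopologicalSpace.induced (fun R : ValO K O => valSign R.1) inferInstance
     CompactSpace (ValO K O) ∧ T2Space (ValO K O) ∧
       TotallyDisconnectedSpace (ValO K O)) := by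
  have hinj : Function.Injective (fun R : ValO K O => valSign R.1) := by
    intro R S h
    apply Subtype.ext
    ext f
    by_cases hf : f = 0
    · subst hf
      exact ⟨fun _ => S.1.zero_mem, fun _ => R.1.zero_mem⟩
    · have h' : valSign R.1 = valSign S.1 := h
      rw [← valSign_ne_iff R.1 ⟨f, hf⟩, ← valSign_ne_iff S.1 ⟨f, hf⟩, h']
  have hcl : IsClosed (Set.range fun R : ValO K O => valSign R.1) := by
    rw [range_valSign]
    exact isClosed_goodSign O
  refine ⟨hinj, hcl, ?_⟩
  letI : TopologicalSpace (ValO K O) :=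
    TopologicalSpace.induced (fun R : ValO K O => valSign R.1) inferInstance
  have hemb : Topology.IsClosedEmbedding (fun R : ValO K O => valSign R.1) :=
    ⟨⟨⟨rfl⟩, hinj⟩, hcl⟩
  refine ⟨hemb.compactSpace, hemb.isEmbedding.t2Space, ⟨?_⟩⟩
  exact hemb.isEmbedding.isTotallyDisconnected (isTotallyDisconnected_of_totallyDisconnectedSpace _)
end
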